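/- There exists a set X ⊆ ℕ that is high for paths but neither reticently high for paths nor loquaciously high for paths. -/

import Mathlib

namespace CFT

open Nat.Partrec (Code)

/-- Relativized partial recursive functions: `f` is partial recursive in the
(total) oracle `O : ℕ → ℕ`.  This mirrors Mathlib's `Nat.Partrec`, with an
extra constructor for the oracle. -/
inductive RecursiveIn (O : ℕ → ℕ) : (ℕ →. ℕ) → Prop
  | zero : RecursiveIn O (pure 0)
  | succ : RecursiveIn O Nat.succ
  | left : RecursiveIn O ↑fun n : ℕ => n.unpair.1
  | right : RecursiveIn O ↑fun n : ℕ => n.unpair.2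
  | oracle : RecursiveIn O ↑O
  | pair {f g} : RecursiveIn O f → RecursiveIn O g →
      RecursiveIn O fun n => Nat.pair <$> f n <*> g n
  | comp {f g} : RecursiveIn O f → RecursiveIn O g →
      RecursiveIn O fun n => g n >>= f
  | prec {f g} : RecursiveIn O f → RecursiveIn O g →
      RecursiveIn O (Nat.unpaired fun a n =>
        n.rec (f a) fun y IH => do let i ← IH; g (Nat.pair a (Nat.pair y i)))
  | rfind {f} : RecursiveIn O f →
      RecursiveIn O fun a => Nat.rfind fun n => (fun m => m = 0) <$> f (Nat.pair a n)

/-- Partial functions between `Primcodable` types that are partial recursive in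
the oracle `O`. -/
def PartrecIn (O : ℕ → ℕ) {α σ : Type} [Primcodable α] [Primcodable σ] (f : α →. σ) : Prop :=
  RecursiveIn O fun n =>
    Part.bind (Part.ofOption (Encodable.decode (α := α) n)) fun a => (f a).map Encodable.encode

/-- Total functions between `Primcodable` types that are computable in the oracle `O`. -/
def ComputableIn (O : ℕ → ℕ) {α σ : Type} [Primcodable α] [Primcodable σ] (f : α → σ) : Prop :=
  PartrecIn O (f : α →. σ)

open Classical in
/-- The characteristic function of a set of naturals. -/
noncomputable def chi (A : Set ℕ) : ℕ → ℕ := fun n => if n ∈ A then 1 else 0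

/-- `A` is computably enumerable in (the characteristic function of) `X`. -/
def CEIn (X : Set ℕ) (A : Set ℕ) : Prop :=
  ∃ f : ℕ →. ℕ, PartrecIn (chi X) f ∧ ∀ n, n ∈ A ↔ (f n).Dom

/-- The `e`-th partial computable function `ℕ →. ℕ`. -/
def codeFn (e : ℕ) : ℕ →. ℕ := (Denumerable.ofNat Code e).eval

/-! ### Trees on ℕ -/

def PrefixClosed (T : Set (List ℕ)) : Prop := ∀ l ∈ T, ∀ l' : List ℕ, l' <+: l → l' ∈ T

/-- Index `e` decides a (prefix-closed) tree on `ℕ`. -/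
def DecidesTree (e : ℕ) : Prop :=
  (∀ n, (codeFn e n).Dom) ∧
    PrefixClosed {l : List ℕ | codeFn e (Encodable.encode l) = Part.some 1}

open Classical in
/-- The standard enumeration of computable trees on ℕ; indices that do not
decide a tree denote the empty tree. -/
noncomputable def treeAt (e : ℕ) : Set (List ℕ) :=
  if DecidesTree e then {l : List ℕ | codeFn e (Encodable.encode l) = Part.some 1} else ∅

/-- `f` is a path through the tree `T`: every finite initial segment
`[f 0, …, f (k-1)]` is in `T`. -/
def IsPath (T : Set (List ℕ)) (f : ℕ → ℕ) : Prop := ∀ k, (List.range k).map f ∈ T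

def IllFounded (T : Set (List ℕ)) : Prop := ∃ f, IsPath T f

/-- The set of indices of well-founded computable trees. -/
def WF : Set ℕ := {e | ¬ IllFounded (treeAt e)}

/-- `T` is a computable tree (prefix-closed and decided by a total computable function). -/
def ComputableTree (T : Set (List ℕ)) : Prop :=
  PrefixClosed T ∧ ∃ χ : List ℕ → Bool, Computable χ ∧ ∀ l, l ∈ T ↔ χ l = true

/-! ### Highness notions for paths -/

def HighForPaths (X : Set ℕ) : Prop :=
  ∀ T : Set (List ℕ), ComputableTree T → IllFounded T →
    ∃ f : ℕ → ℕ, ComputableIn (chi X) f ∧ IsPath T f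

def LoqHighForPaths (X : Set ℕ) : Prop :=
  ∃ F : ℕ × ℕ → ℕ, ComputableIn (chi X) F ∧
    ∀ e, IllFounded (treeAt e) → IsPath (treeAt e) fun n => F (e, n)

def UnifHighForPaths (X : Set ℕ) : Prop :=
  ∃ F : ℕ × ℕ →. ℕ, PartrecIn (chi X) F ∧
    ∀ e, IllFounded (treeAt e) →
      ∃ g : ℕ → ℕ, IsPath (treeAt e) g ∧ ∀ n, F (e, n) = Part.some (g n)

def RetHighForPaths (X : Set ℕ) : Prop :=
  ∃ F : ℕ × ℕ →. ℕ, PartrecIn (chi X) F ∧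
    (∀ e, IllFounded (treeAt e) →
      ∃ g : ℕ → ℕ, IsPath (treeAt e) g ∧ ∀ n, F (e, n) = Part.some (g n)) ∧
    (∀ e, ¬ IllFounded (treeAt e) → ∀ n, ¬ (F (e, n)).Dom)

/-! ### Σ¹₁ and Π¹₁ sets -/

def Sigma11 (A : Set ℕ) : Prop :=
  ∃ R : ℕ → List ℕ → Bool, Computable₂ R ∧
    ∀ n, n ∈ A ↔ ∃ f : ℕ → ℕ, ∀ k, R n ((List.range k).map f) = true

def Pi11 (A : Set ℕ) : Prop := Sigma11 Aᶜ

/-! ### Linear orders -/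

/-- A (presentation of a) linear order: a domain `D ⊆ ℕ` and a strict order
relation on it. -/
structure LinOrd where
  dom : Set ℕ
  lt : ℕ → ℕ → Prop

/-- `L` really is a strict linear order on its domain. -/
def LinOrd.IsValid (L : LinOrd) : Prop :=
  (∀ a b, L.lt a b → a ∈ L.dom ∧ b ∈ L.dom) ∧
  (∀ a, ¬ L.lt a a) ∧
  (∀ a b c, L.lt a b → L.lt b c → L.lt a c) ∧
  (∀ a ∈ L.dom, ∀ b ∈ L.dom, a = b ∨ L.lt a b ∨ L.lt b a)

def linOrdOfCodes (n : ℕ) : LinOrd :=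
  ⟨{a | codeFn n.unpair.1 a = Part.some 1},
   fun a b => codeFn n.unpair.2 (Nat.pair a b) = Part.some 1⟩

def DecidesLinOrd (n : ℕ) : Prop :=
  (∀ m, (codeFn n.unpair.1 m).Dom) ∧ (∀ m, (codeFn n.unpair.2 m).Dom) ∧
    (linOrdOfCodes n).IsValid

open Classical in
/-- The standard enumeration of computable linear orders; indices that do not
decide a linear order denote the empty order. -/
noncomputable def linOrdAt (n : ℕ) : LinOrd :=
  if DecidesLinOrd n then linOrdOfCodes n else ⟨∅, fun _ _ => False⟩

def IsDescSeq (L : LinOrd) (f : ℕ → ℕ) : Prop :=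
  ∀ i, f i ∈ L.dom ∧ L.lt (f (i + 1)) (f i)

def LinOrd.IllFounded (L : LinOrd) : Prop := ∃ f, IsDescSeq L f

/-- A tight descending sequence: a descending sequence that gets below every
descending sequence. -/
def IsTightDescSeq (L : LinOrd) (f : ℕ → ℕ) : Prop :=
  IsDescSeq L f ∧ ∀ g, IsDescSeq L g → ∀ n, ∃ m, L.lt (f m) (g n)

/-- `L` is a computable linear order. -/
def ComputableLinOrd (L : LinOrd) : Prop :=
  L.IsValid ∧
  (∃ χ : ℕ → Bool, Computable χ ∧ ∀ a, a ∈ L.dom ↔ χ a = true) ∧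
  (∃ χ : ℕ → ℕ → Bool, Computable₂ χ ∧ ∀ a b, L.lt a b ↔ χ a b = true)

def LoqHighForDS (X : Set ℕ) : Prop :=
  ∃ g : ℕ × ℕ → ℕ, ComputableIn (chi X) g ∧
    ∀ n, (linOrdAt n).IllFounded → IsDescSeq (linOrdAt n) fun k => g (n, k)

def HighForTightDS (X : Set ℕ) : Prop :=
  ∀ L : LinOrd, ComputableLinOrd L → L.IllFounded →
    ∃ f : ℕ → ℕ, ComputableIn (chi X) f ∧ IsTightDescSeq L f

def UnifHighForTightDS (X : Set ℕ) : Prop :=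
  ∃ F : ℕ × ℕ →. ℕ, PartrecIn (chi X) F ∧
    ∀ n, (linOrdAt n).IllFounded →
      ∃ g : ℕ → ℕ, IsTightDescSeq (linOrdAt n) g ∧ ∀ k, F (n, k) = Part.some (g k)

/-! ### Binary trees -/

def PrefixClosedB (B : Set (List Bool)) : Prop := ∀ l ∈ B, ∀ l' : List Bool, l' <+: l → l' ∈ B

def DecidesBTree (e : ℕ) : Prop :=
  (∀ n, (codeFn e n).Dom) ∧
    PrefixClosedB {l : List Bool | codeFn e (Encodable.encode l) = Part.some 1}

open Classical in
/-- The standard enumeration of computable binary trees; indices that do not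
decide a binary tree denote the full binary tree. -/
noncomputable def bTreeAt (e : ℕ) : Set (List Bool) :=
  if DecidesBTree e then {l : List Bool | codeFn e (Encodable.encode l) = Part.some 1}
  else Set.univ

def BInfinite (B : Set (List Bool)) : Prop := ∀ k, ∃ l ∈ B, l.length = k

def IsBPath (B : Set (List Bool)) (p : ℕ → Bool) : Prop := ∀ k, (List.range k).map p ∈ B


open Encodable Denumerable

/-- The finite initial segment `[G 0, …, G (k - 1)]`. -/
def initSeg (G : ℕ → ℕ) (k : ℕ) : List ℕ := (List.range k).map G

@[simp] theorem length_initSeg (G : ℕ → ℕ) (k : ℕ) : (initSeg G k).length = k := by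
  simp [initSeg]

theorem initSeg_eq_iff {G H : ℕ → ℕ} {k : ℕ} :
    initSeg G k = initSeg H k ↔ ∀ i < k, G i = H i := by
  simp [initSeg, List.map_inj_left]

theorem getD_initSeg {G : ℕ → ℕ} {k i : ℕ} (h : i < k) : (initSeg G k).getD i 0 = G i := by
  simp [initSeg, List.getD_eq_getElem?_getD, h]

theorem initSeg_prefix (G : ℕ → ℕ) {j k : ℕ} (h : j ≤ k) : initSeg G j <+: initSeg G k := by
  obtain ⟨d, rfl⟩ := Nat.exists_eq_add_of_le h
  rw [initSeg, initSeg, List.range_add, List.map_append]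
  exact List.prefix_append _ _

theorem take_initSeg (G : ℕ → ℕ) {j k : ℕ} (h : j ≤ k) : (initSeg G k).take j = initSeg G j := by
  have := List.prefix_iff_eq_take.1 (initSeg_prefix G h)
  rw [length_initSeg] at this
  exact this.symm

/-! ### Oracle computations -/

namespace RecursiveIn

variable {O O' : ℕ → ℕ} {f g : ℕ →. ℕ}

theorem of_eq (h : RecursiveIn O f) (hfg : ∀ n, f n = g n) : RecursiveIn O g :=
  funext hfg ▸ h

theorem of_partrec (h : Nat.Partrec f) : RecursiveIn O f := by
  induction h with
  | zero => exact .zero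
  | succ => exact .succ
  | left => exact .left
  | right => exact .right
  | pair _ _ hf hg => exact .pair hf hg
  | comp _ _ hf hg => exact .comp hf hg
  | prec _ _ hf hg => exact .prec hf hg
  | rfind _ hf => exact .rfind hf

theorem of_computable {f : ℕ → ℕ} (h : Computable f) : RecursiveIn O f :=
  of_partrec (Partrec.nat_iff.1 h)

theorem trans (h : RecursiveIn O f) (hO : RecursiveIn O' O) : RecursiveIn O' f := by
  induction h with
  | zero => exact .zero
  | succ => exact .succ
  | left => exact .left
  | right => exact .right
  | oracle => exact hO
  | pair _ _ hf hg => exact .pair hf hg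
  | comp _ _ hf hg => exact .comp hf hg
  | prec _ _ hf hg => exact .prec hf hg
  | rfind _ hf => exact .rfind hf

theorem comp_total {f g : ℕ → ℕ} (hf : RecursiveIn O f) (hg : RecursiveIn O g) :
    RecursiveIn O fun n => f (g n) := by
  have h := RecursiveIn.comp hf hg
  have e : (fun n => (g : ℕ →. ℕ) n >>= (f : ℕ →. ℕ)) = ((fun n => f (g n) : ℕ → ℕ) : ℕ →. ℕ) :=
    funext fun n => Part.bind_some (g n) (f : ℕ →. ℕ)
  rwa [e] at h

theorem pair_total {f g : ℕ → ℕ} (hf : RecursiveIn O f) (hg : RecursiveIn O g) :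
    RecursiveIn O fun n => Nat.pair (f n) (g n) := by
  have := RecursiveIn.pair hf hg
  simpa [Seq.seq] using this

/-- Every function recursive in `O` is computed, continuously and monotonically, from finite
initial segments of `O` by a single partial recursive function. -/
theorem exists_finite_use (h : RecursiveIn O f) :
    ∃ Ψ : List ℕ × ℕ →. ℕ, Partrec Ψ ∧
      (∀ σ τ n x, σ <+: τ → x ∈ Ψ (σ, n) → x ∈ Ψ (τ, n)) ∧
      ∀ n x, x ∈ f n ↔ ∃ k, x ∈ Ψ (initSeg O k, n) := by
  have plain : ∀ f : ℕ →. ℕ, Nat.Partrec f → ∃ Ψ : List ℕ × ℕ →. ℕ, Partrec Ψ ∧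
      (∀ σ τ n x, σ <+: τ → x ∈ Ψ (σ, n) → x ∈ Ψ (τ, n)) ∧
      ∀ n x, x ∈ f n ↔ ∃ k, x ∈ Ψ (initSeg O k, n) := fun f hf =>
    ⟨fun p => f p.2, (Partrec.nat_iff.2 hf).comp Computable.snd, fun _ _ _ _ _ h => h, by simp⟩
  induction h with
  | zero => exact plain _ .zero
  | succ => exact plain _ .succ
  | left => exact plain _ .left
  | right => exact plain _ .right
  | oracle =>
    refine ⟨fun p => (p.1[p.2]? : Option ℕ),
      Computable.ofOption (Computable.list_getElem?.comp Computable.fst Computable.snd), ?_, ?_⟩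
    · intro σ τ n x hστ hx
      simp only [Part.mem_ofOption, Option.mem_def] at hx ⊢
      obtain ⟨t, rfl⟩ := hστ
      rw [List.getElem?_append_left (List.getElem?_eq_some_iff.1 hx).1, hx]
    · intro n x
      simp only [PFun.coe_val, Part.mem_some_iff, Part.mem_ofOption, Option.mem_def, initSeg,
        List.getElem?_map, Option.map_eq_some_iff]
      constructor
      · rintro rfl
        exact ⟨n + 1, n, by simp, rfl⟩
      · rintro ⟨k, m, hm, rfl⟩
        rw [List.getElem?_eq_some_iff] at hm
        obtain ⟨_, hm⟩ := hm
        simp at hm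
        rw [hm]
  | @pair f g _ _ ihf ihg =>
    obtain ⟨F, hF, mF, cF⟩ := ihf
    obtain ⟨K, hK, mK, cK⟩ := ihg
    refine ⟨fun p => (F p).bind fun a => (K p).map fun b => Nat.pair a b, ?_, ?_, ?_⟩
    · exact hF.bind ((hK.comp Computable.fst).map
        (Primrec₂.natPair.to_comp.comp (Computable.snd.comp Computable.fst) Computable.snd))
    · intro σ τ n x hστ
      simp only [Part.mem_bind_iff, Part.mem_map_iff]
      rintro ⟨a, ha, b, hb, rfl⟩
      exact ⟨a, mF _ _ _ _ hστ ha, b, mK _ _ _ _ hστ hb, rfl⟩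
    · intro n x
      simp only [Seq.seq, Part.map_eq_map, Part.mem_bind_iff, Part.mem_map_iff, cF, cK]
      constructor
      · rintro ⟨_, ⟨a, ⟨k, ha⟩, rfl⟩, b, ⟨l, hb⟩, rfl⟩
        exact ⟨max k l, a, mF _ _ _ _ (initSeg_prefix O (le_max_left k l)) ha, b,
          mK _ _ _ _ (initSeg_prefix O (le_max_right k l)) hb, rfl⟩
      · rintro ⟨k, a, ha, b, hb, rfl⟩
        exact ⟨_, ⟨a, ⟨k, ha⟩, rfl⟩, b, ⟨k, hb⟩, rfl⟩
  | @comp f g _ _ ihf ihg =>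
    obtain ⟨F, hF, mF, cF⟩ := ihf
    obtain ⟨K, hK, mK, cK⟩ := ihg
    refine ⟨fun p => (K p).bind fun a => F (p.1, a), ?_, ?_, ?_⟩
    · exact hK.bind (hF.comp (Computable.pair (Computable.fst.comp Computable.fst) Computable.snd))
    · intro σ τ n x hστ
      simp only [Part.mem_bind_iff]
      rintro ⟨a, ha, hx⟩
      exact ⟨a, mK _ _ _ _ hστ ha, mF _ _ _ _ hστ hx⟩
    · intro n x
      refine Part.mem_bind_iff.trans ⟨?_, ?_⟩
      · rintro ⟨a, ha, hx⟩
        obtain ⟨k, ha⟩ := (cK n a).1 ha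
        obtain ⟨l, hx⟩ := (cF a x).1 hx
        exact ⟨max k l, Part.mem_bind_iff.2
          ⟨a, mK _ _ _ _ (initSeg_prefix O (le_max_left k l)) ha,
            mF _ _ _ _ (initSeg_prefix O (le_max_right k l)) hx⟩⟩
      · rintro ⟨k, h⟩
        obtain ⟨a, ha, hx⟩ := Part.mem_bind_iff.1 h
        exact ⟨a, (cK n a).2 ⟨k, ha⟩, (cF a x).2 ⟨k, hx⟩⟩
  | @prec f g _ _ ihf ihg =>
    obtain ⟨F, hF, mF, cF⟩ := ihf
    obtain ⟨K, hK, mK, cK⟩ := ihg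
    let rec' : List ℕ → ℕ → ℕ → Part ℕ := fun σ a n =>
      n.rec (F (σ, a)) fun y IH => IH.bind fun i => K (σ, Nat.pair a (Nat.pair y i))
    have mono : ∀ σ τ a n x, σ <+: τ → x ∈ rec' σ a n → x ∈ rec' τ a n := by
      intro σ τ a n x hστ
      induction n generalizing x with
      | zero => exact mF _ _ _ _ hστ
      | succ y ih =>
        simp only [rec', Part.mem_bind_iff]
        rintro ⟨i, hi, hx⟩
        exact ⟨i, ih i hi, mK _ _ _ _ hστ hx⟩
    refine ⟨fun p => rec' p.1 p.2.unpair.1 p.2.unpair.2, ?_, ?_, ?_⟩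
    · refine Partrec.nat_rec (f := fun p : List ℕ × ℕ => p.2.unpair.2)
        (g := fun p => F (p.1, p.2.unpair.1))
        (h := fun p q => K (p.1, Nat.pair p.2.unpair.1 (Nat.pair q.1 q.2))) ?_ ?_ ?_
      · exact (Computable.snd.comp Computable.unpair).comp Computable.snd
      · exact hF.comp (Computable.fst.pair
          ((Computable.fst.comp Computable.unpair).comp Computable.snd))
      · refine hK.comp ((Computable.fst.comp Computable.fst).pair ?_)
        refine Primrec₂.natPair.to_comp.comp
          ((Computable.fst.comp Computable.unpair).comp (Computable.snd.comp Computable.fst)) ?_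
        exact Primrec₂.natPair.to_comp.comp (Computable.fst.comp Computable.snd)
          (Computable.snd.comp Computable.snd)
    · intro σ τ n x hστ
      exact mono _ _ _ _ _ hστ
    · intro n x
      simp only [Nat.unpaired]
      generalize n.unpair.1 = a
      generalize n.unpair.2 = m
      induction m generalizing x with
      | zero => exact cF _ _
      | succ y ih =>
        simp only [rec', Part.bind_eq_bind, Part.mem_bind_iff, cK] at ih ⊢
        constructor
        · rintro ⟨i, hi, l, hx⟩
          obtain ⟨k, hi⟩ := (ih i).1 hi
          exact ⟨max k l, i, mono _ _ _ _ _ (initSeg_prefix O (le_max_left k l)) hi,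
            mK _ _ _ _ (initSeg_prefix O (le_max_right k l)) hx⟩
        · rintro ⟨k, i, hi, hx⟩
          exact ⟨i, (ih i).2 ⟨k, hi⟩, k, hx⟩
  | @rfind f _ ihf =>
    obtain ⟨F, hF, mF, cF⟩ := ihf
    refine ⟨fun p => Nat.rfind fun n => (F (p.1, Nat.pair p.2 n)).map fun m => decide (m = 0),
      ?_, ?_, ?_⟩
    · refine Partrec.rfind ((hF.comp ((Computable.fst.comp Computable.fst).pair
        (Primrec₂.natPair.to_comp.comp (Computable.snd.comp Computable.fst)
          Computable.snd))).map ?_)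
      exact ((PrimrecPred.decide (Primrec.eq.comp Primrec.id (Primrec.const 0))).to_comp.comp
        Computable.snd)
    · intro σ τ n x hστ h
      have up : ∀ m b, b ∈ (F (σ, Nat.pair n m)).map (fun m => decide (m = 0)) →
          b ∈ (F (τ, Nat.pair n m)).map fun m => decide (m = 0) := by
        intro m b hb
        obtain ⟨a, ha, rfl⟩ := (Part.mem_map_iff _).1 hb
        exact Part.mem_map _ (mF _ _ _ _ hστ ha)
      obtain ⟨h₁, h₂⟩ := Nat.mem_rfind.1 h
      exact Nat.mem_rfind.2 ⟨up _ _ h₁, fun hm => up _ _ (h₂ hm)⟩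
    · intro n x
      have eqv : ∀ m b, b ∈ (f (Nat.pair n m)).map (fun m => decide (m = 0)) ↔
          ∃ k, b ∈ (F (initSeg O k, Nat.pair n m)).map fun m => decide (m = 0) := by
        intro m b
        constructor
        · intro hb
          obtain ⟨a, ha, rfl⟩ := (Part.mem_map_iff _).1 hb
          obtain ⟨k, ha⟩ := (cF _ _).1 ha
          exact ⟨k, Part.mem_map _ ha⟩
        · rintro ⟨k, hb⟩
          obtain ⟨a, ha, rfl⟩ := (Part.mem_map_iff _).1 hb
          exact Part.mem_map _ ((cF _ _).2 ⟨k, ha⟩)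
      have up : ∀ k l m b, k ≤ l →
          b ∈ (F (initSeg O k, Nat.pair n m)).map (fun m => decide (m = 0)) →
          b ∈ (F (initSeg O l, Nat.pair n m)).map fun m => decide (m = 0) := by
        intro k l m b hkl hb
        obtain ⟨a, ha, rfl⟩ := (Part.mem_map_iff _).1 hb
        exact Part.mem_map _ (mF _ _ _ _ (initSeg_prefix O hkl) ha)
      refine Nat.mem_rfind.trans ⟨?_, ?_⟩
      · rintro ⟨h₁, h₂⟩
        obtain ⟨k, hk⟩ := (eqv _ _).1 h₁
        have h' : ∀ m < x, ∃ l, false ∈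
            (F (initSeg O l, Nat.pair n m)).map fun m => decide (m = 0) :=
          fun m hm => (eqv _ _).1 (h₂ hm)
        choose! l hl using h'
        have le : ∀ m < x, l m ≤ (Finset.range x).sup l := fun m hm =>
          Finset.le_sup (Finset.mem_range.2 hm)
        exact ⟨max k ((Finset.range x).sup l), Nat.mem_rfind.2
          ⟨up _ _ _ _ (le_max_left _ _) hk,
            fun {m} hm => up _ _ _ _ ((le m hm).trans (le_max_right _ _)) (hl m hm)⟩⟩
      · rintro ⟨k, h⟩
        obtain ⟨h₁, h₂⟩ := Nat.mem_rfind.1 h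
        exact ⟨(eqv _ _).2 ⟨k, h₁⟩, fun hm => (eqv _ _).2 ⟨k, h₂ hm⟩⟩

end RecursiveIn

/-- The program `c`, given the finite oracle `σ` and the input `n`, halts within `j` steps. -/
def haltsBy (c : Code) (σ : List ℕ) (n j : ℕ) : Bool :=
  (c.evaln j (Nat.pair (encode σ) n)).isSome

/-- The `c`-th set enumerated relative to `G`. -/
def enumSet (c : Code) (G : ℕ → ℕ) : Set ℕ := {n | ∃ m j, haltsBy c (initSeg G m) n j = true}

theorem primrec_haltsBy (c : Code) :
    Primrec fun p : List ℕ × ℕ × ℕ => haltsBy c p.1 p.2.1 p.2.2 := by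
  refine Primrec.option_isSome.comp (Code.primrec_evaln.comp (.pair (.pair ?_ (.const c)) ?_))
  · exact Primrec.snd.comp Primrec.snd
  · exact Primrec₂.natPair.comp (Primrec.encode.comp Primrec.fst) (Primrec.fst.comp Primrec.snd)

theorem evaln_isSome_mono {c : Code} {i j n : ℕ} (h : i ≤ j)
    (hi : (c.evaln i n).isSome = true) : (c.evaln j n).isSome = true := by
  obtain ⟨x, hx⟩ := Option.isSome_iff_exists.1 hi
  exact Option.isSome_iff_exists.2 ⟨x, Code.evaln_mono h hx⟩

theorem eval_dom_iff_evaln_isSome {c : Code} {n : ℕ} :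
    (c.eval n).Dom ↔ ∃ j, (c.evaln j n).isSome = true := by
  simp only [Part.dom_iff_mem, Code.evaln_complete, Option.isSome_iff_exists, Option.mem_def]
  exact exists_comm

theorem RecursiveIn.exists_enumSet_eq {O : ℕ → ℕ} {f : ℕ →. ℕ} (h : RecursiveIn O f) :
    ∃ c, ∀ n, (f n).Dom ↔ n ∈ enumSet c O := by
  obtain ⟨Ψ, hΨ, -, hf⟩ := h.exists_finite_use
  obtain ⟨c, hc⟩ := Code.exists_code.1 hΨ
  refine ⟨c, fun n => ?_⟩
  have key : ∀ k, (Ψ (initSeg O k, n)).Dom ↔ ∃ j, haltsBy c (initSeg O k) n j = true := by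
    intro k
    simp only [haltsBy, ← eval_dom_iff_evaln_isSome, hc]
    rw [show Nat.pair (encode (initSeg O k)) n = encode (initSeg O k, n) from rfl, encodek]
    simp only [Part.coe_some, Part.bind_some]
    exact Iff.rfl
  simp only [enumSet, Set.mem_ofPred_eq, ← key, Part.dom_iff_mem, hf]
  exact exists_comm

/-! ### A `Σ¹₁`-complete family of computable trees -/

/-- The tree of those sequences all of whose initial segments look outside the domain of `c`,
as far as a computation of bounded length can tell. -/
def haltFree (c : Code) (l : List ℕ) : Bool :=
  decide (∀ i < l.length + 1, (c.evaln l.length (encode (l.take i))).isSome = false)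

theorem haltFree_iff {c : Code} {l : List ℕ} :
    haltFree c l = true ↔ ∀ i ≤ l.length, (c.evaln l.length (encode (l.take i))).isSome = false := by
  simp [haltFree]

theorem primrec_haltFree : Primrec₂ haltFree := by
  have h : PrimrecRel fun (i : ℕ) (p : Code × List ℕ) =>
      (p.1.evaln p.2.length (encode (p.2.take i))).isSome = false := by
    refine Primrec.eq.comp (Primrec.option_isSome.comp (Code.primrec_evaln.comp
      (.pair (.pair ?_ ?_) ?_))) (.const false)
    · exact Primrec.list_length.comp (Primrec.snd.comp Primrec.snd)
    · exact Primrec.fst.comp Primrec.snd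
    · exact Primrec.encode.comp
        (Primrec.list_take.comp Primrec.fst (Primrec.snd.comp Primrec.snd))
  have h' : PrimrecPred fun p : Code × List ℕ => ∀ i < p.2.length + 1,
      (p.1.evaln p.2.length (encode (p.2.take i))).isSome = false :=
    (h.forall_mem_list.comp (Primrec.list_range.comp (Primrec.succ.comp
      (Primrec.list_length.comp Primrec.snd))) Primrec.id).of_eq fun p => by
        simp only [List.mem_range]; rfl
  exact h'.decide

theorem prefixClosed_haltFree (c : Code) : PrefixClosed {l | haltFree c l = true} := by
  intro l hl l' hl'
  simp only [Set.mem_ofPred_eq, haltFree_iff] at hl ⊢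
  intro i hi
  have hlen := hl'.length_le
  have := hl i (hi.trans hlen)
  rw [List.prefix_iff_eq_take] at hl'
  rw [hl', List.take_take, ← hl', min_eq_left hi]
  by_contra h
  rw [Bool.not_eq_false] at h
  rw [evaln_isSome_mono hlen h] at this
  cases this

theorem forall_haltFree_iff {c : Code} {f : ℕ → ℕ} :
    (∀ k, haltFree c (initSeg f k) = true) ↔ ∀ k, ¬ (c.eval (encode (initSeg f k))).Dom := by
  simp only [haltFree_iff, eval_dom_iff_evaln_isSome, length_initSeg, not_exists,
    Bool.not_eq_true]
  constructor
  · intro h k j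
    have := h (max k j) k (le_max_left _ _)
    rw [take_initSeg _ (le_max_left _ _)] at this
    by_contra hj
    rw [Bool.not_eq_false] at hj
    rw [evaln_isSome_mono (le_max_right k j) hj] at this
    cases this
  · intro h k i hi
    rw [take_initSeg _ hi]
    exact h i k

theorem exists_treeAt_eq_haltFree :
    ∃ r : ℕ → ℕ, Computable r ∧ ∀ n, treeAt (r n) = {l | haltFree (ofNat Code n) l = true} := by
  have hp : Primrec fun x : ℕ =>
      (haltFree (ofNat Code x.unpair.1) (ofNat (List ℕ) x.unpair.2)).toNat :=
    (Primrec.dom_bool Bool.toNat).comp (primrec_haltFree.comp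
      ((Primrec.ofNat Code).comp (Primrec.fst.comp Primrec.unpair))
      ((Primrec.ofNat (List ℕ)).comp (Primrec.snd.comp Primrec.unpair)))
  obtain ⟨d, hd⟩ := Code.exists_code.1 (Partrec.nat_iff.1 hp.to_comp)
  refine ⟨fun n => encode (d.curry n),
    (Primrec.encode.comp (Code.primrec₂_curry.comp (.const d) .id)).to_comp, fun n => ?_⟩
  have hcode : ∀ x, codeFn (encode (d.curry n)) x =
      Part.some (haltFree (ofNat Code n) (ofNat (List ℕ) x)).toNat := by
    intro x
    rw [codeFn, ofNat_encode, Code.eval_curry, hd]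
    simp
  have hset : {l : List ℕ | codeFn (encode (d.curry n)) (encode l) = Part.some 1} =
      {l | haltFree (ofNat Code n) l = true} := by
    ext l
    simp only [Set.mem_ofPred_eq, hcode, ofNat_encode, Part.some_inj]
    cases haltFree (ofNat Code n) l <;> simp
  have hdec : DecidesTree (encode (d.curry n)) :=
    ⟨fun x => by rw [hcode]; trivial, by rw [hset]; exact prefixClosed_haltFree _⟩
  rw [treeAt, if_pos hdec, hset]

/-- The indices of ill-founded trees in the family `haltFree`. -/
def illIndices : Set ℕ := {n | ∃ f, ∀ k, haltFree (ofNat Code n) (initSeg f k) = true}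

theorem not_sigma11_compl_illIndices {R : ℕ → List ℕ → Bool} (hR : Computable₂ R) :
    ¬ ∀ n, n ∉ illIndices ↔ ∃ f, ∀ k, R n (initSeg f k) = true := by
  intro h
  have hF : Partrec₂ fun (c : Code) (x : ℕ) =>
      cond (R (encode c) (ofNat (List ℕ) x)) Part.none (Part.some 0) :=
    Partrec.cond (hR.comp (Computable.encode.comp Computable.fst)
      ((Computable.ofNat _).comp Computable.snd)) Partrec.none (Computable.const 0)
  obtain ⟨c, hc⟩ := Code.fixed_point₂ hF
  have key : ∀ l : List ℕ, (c.eval (encode l)).Dom ↔ R (encode c) l = false := by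
    intro l
    rw [hc]
    cases hl : R (encode c) l <;> simp [hl]
  have : encode c ∈ illIndices ↔ ∃ f, ∀ k, R (encode c) (initSeg f k) = true := by
    simp only [illIndices, Set.mem_ofPred_eq, ofNat_encode, forall_haltFree_iff, key,
      Bool.not_eq_false]
  exact iff_not_self (this.trans (h _).symm)

/-- A `Σ¹₁` set of indices of well-founded trees misses one of them. -/
theorem exists_notMem_illIndices_of_sigma11 {R : ℕ → List ℕ → Bool} (hR : Computable₂ R)
    (h : ∀ n f, (∀ k, R n (initSeg f k) = true) → n ∉ illIndices) :
    ∃ n, n ∉ illIndices ∧ ∀ f, ¬ ∀ k, R n (initSeg f k) = true := by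
  by_contra! hn
  exact not_sigma11_compl_illIndices hR fun n => ⟨hn n, fun ⟨f, hf⟩ => h n f hf⟩

/-! ### Rows with finitely many locked entries -/

/-- The first `k` entries of the row coded by a number. -/
def rowTrunc : ℕ → ℕ → ℕ
  | 0, _ => 0
  | k + 1, v => Nat.pair v.unpair.1 (rowTrunc k v.unpair.2)

/-- The entry with index `k` of the row coded by a number. -/
def rowEntry : ℕ → ℕ → ℕ
  | 0, v => v.unpair.1
  | k + 1, v => rowEntry k v.unpair.2

theorem primrec_rowTrunc (k : ℕ) : Primrec (rowTrunc k) := by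
  induction k with
  | zero => exact Primrec.const 0
  | succ k ih =>
    exact Primrec₂.natPair.comp (Primrec.fst.comp Primrec.unpair)
      (ih.comp (Primrec.snd.comp Primrec.unpair))

theorem primrec_rowEntry (k : ℕ) : Primrec (rowEntry k) := by
  induction k with
  | zero => exact Primrec.fst.comp Primrec.unpair
  | succ k ih => exact ih.comp (Primrec.snd.comp Primrec.unpair)

theorem exists_rowTrunc_eq_rowEntry_eq (k v b : ℕ) :
    ∃ w, rowTrunc k w = rowTrunc k v ∧ rowEntry k w = b := by
  induction k generalizing v with
  | zero => exact ⟨Nat.pair b 0, rfl, by simp [rowEntry]⟩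
  | succ k ih =>
    obtain ⟨w, hw, hb⟩ := ih v.unpair.2
    exact ⟨Nat.pair v.unpair.1 w, by simp [rowTrunc, hw], by simp [rowEntry, hb]⟩

theorem rowTrunc_succ_eq {k v w : ℕ} (h : rowTrunc (k + 1) v = rowTrunc (k + 1) w) :
    rowTrunc k v = rowTrunc k w ∧ rowEntry k v = rowEntry k w := by
  induction k generalizing v w with
  | zero => exact ⟨rfl, (Nat.pair_eq_pair.1 h).1⟩
  | succ k ih =>
    obtain ⟨h₁, h₂⟩ := Nat.pair_eq_pair.1 h
    obtain ⟨h₃, h₄⟩ := ih h₂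
    exact ⟨Nat.pair_eq_pair.2 ⟨h₁, h₃⟩, h₄⟩

/-- The information about the value `v` at the argument `i` that is fixed when the arguments
below `s` and, elsewhere, the first `k` entries of each row are locked. -/
def lockedPart (s k i v : ℕ) : ℕ := if i < s then v else rowTrunc k v

theorem primrec_lockedPart (s k : ℕ) : Primrec₂ (lockedPart s k) :=
  Primrec.ite (Primrec.nat_lt.comp Primrec.fst (.const s)) Primrec.snd
    ((primrec_rowTrunc k).comp Primrec.snd)

/-- `G` and `H` agree on all locked information. -/
def LockEq (s k : ℕ) (G H : ℕ → ℕ) : Prop :=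
  ∀ i, lockedPart s k i (G i) = lockedPart s k i (H i)

theorem LockEq.mono {s s' k : ℕ} {G H : ℕ → ℕ} (hs : s ≤ s') (h : LockEq s' k G H) :
    LockEq s k G H := by
  intro i
  have := h i
  simp only [lockedPart] at this ⊢
  split_ifs at this ⊢ <;> first | omega | simp_all

theorem LockEq.eq_of_lt {s k i : ℕ} {G H : ℕ → ℕ} (h : LockEq s k G H) (hi : i < s) :
    G i = H i := by
  simpa [lockedPart, hi] using h i

theorem LockEq.rowTrunc_eq {s k i : ℕ} {G H : ℕ → ℕ} (h : LockEq s k G H) (hi : s ≤ i) :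
    rowTrunc k (G i) = rowTrunc k (H i) := by
  simpa [lockedPart, hi.not_gt] using h i

theorem LockEq.of_succ {s k : ℕ} {G H : ℕ → ℕ} (h : LockEq s (k + 1) G H) : LockEq s k G H := by
  intro i
  rcases lt_or_ge i s with hi | hi
  · rw [h.eq_of_lt hi]
  · simpa [lockedPart, hi.not_gt] using (rowTrunc_succ_eq (h.rowTrunc_eq hi)).1

/-- The finite sequence `τ` agrees with an initial segment of `ρ` on all locked information. -/
def lockCompat (s k : ℕ) (τ ρ : List ℕ) : Bool :=
  decide (τ.length ≤ ρ.length) &&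
    decide ((List.range τ.length).map (fun i => lockedPart s k i (τ.getD i 0)) =
      (List.range τ.length).map fun i => lockedPart s k i (ρ.getD i 0))

theorem primrec_lockCompat (s k : ℕ) : Primrec₂ (lockCompat s k) := by
  refine Primrec.and.comp
    (PrimrecPred.decide (Primrec.nat_le.comp (Primrec.list_length.comp Primrec.fst)
      (Primrec.list_length.comp Primrec.snd)))
    (PrimrecPred.decide (Primrec.eq.comp (Primrec.list_map ?_ ?_) (Primrec.list_map ?_ ?_)))
  · exact Primrec.list_range.comp (Primrec.list_length.comp Primrec.fst)
  · exact (primrec_lockedPart s k).comp Primrec.snd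
      ((Primrec.list_getD 0).comp (Primrec.fst.comp Primrec.fst) Primrec.snd)
  · exact Primrec.list_range.comp (Primrec.list_length.comp Primrec.fst)
  · exact (primrec_lockedPart s k).comp Primrec.snd
      ((Primrec.list_getD 0).comp (Primrec.snd.comp Primrec.fst) Primrec.snd)

theorem lockCompat_initSeg {s k m : ℕ} {τ : List ℕ} {G : ℕ → ℕ} :
    lockCompat s k τ (initSeg G m) = true ↔ τ.length ≤ m ∧
      ∀ i < τ.length, lockedPart s k i (τ.getD i 0) = lockedPart s k i (G i) := by
  simp only [lockCompat, Bool.and_eq_true, decide_eq_true_eq, length_initSeg, List.map_inj_left,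
    List.mem_range]
  refine and_congr_right fun hm => forall₂_congr fun i hi => ?_
  rw [getD_initSeg (hi.trans_le hm)]

/-! ### Forcing conditions -/

/-- A nonempty `Π⁰₁` class, given by a test on initial segments, all of whose members agree below
`height`, and which is invariant under changing, at or above `height`, the row entries with index
at least `width`. -/
structure Condition where
  height : ℕ
  width : ℕ
  test : List ℕ → Bool
  computable_test : Computable test
  nonempty : ∃ G, ∀ k, test (initSeg G k) = true
  invariant : ∀ G H, (∀ k, test (initSeg G k) = true) → LockEq height width G H →
    ∀ k, test (initSeg H k) = true
  agree : ∀ G H, (∀ k, test (initSeg G k) = true) → (∀ k, test (initSeg H k) = true) →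
    ∀ i < height, G i = H i

namespace Condition

/-- The class of functions satisfying a condition. -/
def carrier (p : Condition) : Set (ℕ → ℕ) := {G | ∀ k, p.test (initSeg G k) = true}

theorem exists_restrict (p : Condition) {G : ℕ → ℕ} (hG : G ∈ p.carrier) (m : ℕ) :
    ∃ q : Condition, q.carrier = {H ∈ p.carrier | initSeg H m = initSeg G m} ∧ m ≤ q.height := by
  let t : List ℕ → Bool := fun ρ =>
    p.test ρ && (!decide (ρ.length = m) || decide (ρ = initSeg G m))
  have ht : ∀ H, (∀ k, t (initSeg H k) = true) ↔
      (∀ k, p.test (initSeg H k) = true) ∧ initSeg H m = initSeg G m := by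
    intro H
    simp only [t, Bool.and_eq_true, Bool.or_eq_true, Bool.not_eq_true', decide_eq_false_iff_not,
      length_initSeg, decide_eq_true_eq, forall_and]
    refine and_congr_right fun _ => ⟨fun h => (h m).resolve_left (by simp), fun h k => ?_⟩
    by_cases hk : k = m
    · subst hk
      exact Or.inr h
    · exact Or.inl hk
  refine ⟨⟨max p.height m, p.width, t, ?_, ⟨G, (ht G).2 ⟨hG, rfl⟩⟩, ?_, ?_⟩, ?_, le_max_right _ _⟩
  · refine Primrec.and.to_comp.comp p.computable_test (Primrec.or.comp
      (Primrec.not.comp (PrimrecPred.decide (Primrec.eq.comp Primrec.list_length (.const m))))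
      (PrimrecPred.decide (Primrec.eq.comp Primrec.id (.const _)))).to_comp
  · intro H K hH hHK
    obtain ⟨h₁, h₂⟩ := (ht H).1 hH
    refine (ht K).2 ⟨p.invariant H K h₁ (hHK.mono (le_max_left _ _)), ?_⟩
    rw [← h₂, initSeg_eq_iff]
    exact fun i hi => (hHK.eq_of_lt (hi.trans_le (le_max_right _ _))).symm
  · intro H K hH hK i hi
    obtain ⟨h₁, h₂⟩ := (ht H).1 hH
    obtain ⟨h₃, h₄⟩ := (ht K).1 hK
    rcases lt_max_iff.1 hi with hi | hi
    · exact p.agree H K h₁ h₃ i hi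
    · exact initSeg_eq_iff.1 (h₂.trans h₄.symm) i hi
  · ext H
    exact ht H

theorem exists_le_height (p : Condition) (m : ℕ) :
    ∃ q : Condition, q.carrier ⊆ p.carrier ∧ m ≤ q.height := by
  obtain ⟨G, hG⟩ := p.nonempty
  obtain ⟨q, hq, hm⟩ := p.exists_restrict hG m
  exact ⟨q, hq ▸ fun _ h => h.1, hm⟩

/-- A condition can be strengthened so as to code a path through a given ill-founded tree. -/
theorem exists_path (p : Condition) {χ : List ℕ → Bool} (hχ : Computable χ)
    (hf : ∃ f, ∀ m, χ (initSeg f m) = true) :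
    ∃ q : Condition, q.carrier ⊆ p.carrier ∧ ∃ s k, ∀ G ∈ q.carrier, ∀ m,
      χ (initSeg (fun x => rowEntry k (G (x + s))) m) = true := by
  obtain ⟨f, hf⟩ := hf
  set s := p.height
  set w := p.width
  let t : List ℕ → Bool := fun ρ =>
    p.test ρ && χ ((List.range (ρ.length - s)).map fun x => rowEntry w (ρ.getD (x + s) 0))
  have ht : ∀ G, (∀ k, t (initSeg G k) = true) ↔ (∀ k, p.test (initSeg G k) = true) ∧
      ∀ m, χ (initSeg (fun x => rowEntry w (G (x + s))) m) = true := by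
    intro G
    have e : ∀ k, (List.range ((initSeg G k).length - s)).map
        (fun x => rowEntry w ((initSeg G k).getD (x + s) 0)) =
        initSeg (fun x => rowEntry w (G (x + s))) (k - s) := by
      intro k
      rw [length_initSeg]
      refine List.map_congr_left fun x hx => ?_
      rw [List.mem_range] at hx
      rw [getD_initSeg (by omega)]
    simp only [t, e, Bool.and_eq_true, forall_and]
    refine and_congr_right fun _ => ⟨fun h m => ?_, fun h k => h _⟩
    simpa using h (m + s)
  refine ⟨⟨s, w + 1, t, ?_, ?_, ?_, ?_⟩, fun G hG => ((ht G).1 hG).1, s, w,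
    fun G hG => ((ht G).1 hG).2⟩
  · refine Primrec.and.to_comp.comp p.computable_test (hχ.comp (Primrec.to_comp ?_))
    refine Primrec.list_map (Primrec.list_range.comp
      (Primrec.nat_sub.comp Primrec.list_length (.const s))) ?_
    exact (primrec_rowEntry w).comp ((Primrec.list_getD 0).comp Primrec.fst
      (Primrec.nat_add.comp Primrec.snd (.const s)))
  · obtain ⟨G, hG⟩ := p.nonempty
    choose u hu hu' using fun i => exists_rowTrunc_eq_rowEntry_eq w (G i) (f (i - s))
    refine ⟨fun i => if i < s then G i else u i, (ht _).2 ⟨p.invariant G _ hG fun i => ?_, ?_⟩⟩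
    · by_cases hi : i < s
      · simp [hi]
      · have hi' : ¬ i < p.height := hi
        simp only [lockedPart, hi, hi', if_false]
        exact (hu i).symm
    · simpa [hu'] using hf
  · intro G H hG hGH
    obtain ⟨h₁, h₂⟩ := (ht G).1 hG
    refine (ht H).2 ⟨p.invariant G H h₁ hGH.of_succ, fun m => ?_⟩
    rw [← h₂ m]
    congr 1
    rw [initSeg_eq_iff]
    exact fun i _ => (rowTrunc_succ_eq (hGH.rowTrunc_eq (Nat.le_add_left s i))).2.symm
  · exact fun G H hG hH => p.agree G H ((ht G).1 hG).1 ((ht H).1 hH).1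

theorem exists_forall_mem_enumSet (p : Condition) {c : Code} {n : ℕ} {G : ℕ → ℕ}
    (hG : G ∈ p.carrier) (hn : n ∈ enumSet c G) :
    ∃ q : Condition, q.carrier ⊆ p.carrier ∧ ∀ H ∈ q.carrier, n ∈ enumSet c H := by
  obtain ⟨m, j, h⟩ := hn
  obtain ⟨q, hq, -⟩ := p.exists_restrict hG m
  refine ⟨q, hq ▸ fun _ h => h.1, fun H hH => ⟨m, j, ?_⟩⟩
  rw [hq] at hH
  rw [hH.2, h]

theorem exists_enumSet_ne_compl_illIndices (p : Condition) (c : Code) :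
    ∃ q : Condition, q.carrier ⊆ p.carrier ∧ ∀ G ∈ q.carrier, enumSet c G ≠ illIndicesᶜ := by
  by_cases hcase : ∃ n ∈ illIndices, ∃ G ∈ p.carrier, n ∈ enumSet c G
  · obtain ⟨n, hn, G, hG, hnG⟩ := hcase
    obtain ⟨q, hq, h⟩ := p.exists_forall_mem_enumSet hG hnG
    refine ⟨q, hq, fun H hH e => ?_⟩
    exact (e ▸ h H hH : n ∈ illIndicesᶜ) hn
  · push Not at hcase
    let R : ℕ → List ℕ → Bool := fun n l => p.test l.tail &&
      (!decide (l.length = l.headI.unpair.1 + 1) || haltsBy c l.tail n l.headI.unpair.2)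
    have hR : Computable₂ R := by
      have hd : Primrec fun x : ℕ × List ℕ => x.2.headI.unpair :=
        Primrec.unpair.comp (Primrec.list_headI.comp Primrec.snd)
      have tl : Primrec fun x : ℕ × List ℕ => x.2.tail := Primrec.list_tail.comp Primrec.snd
      refine Primrec.and.to_comp.comp (p.computable_test.comp tl.to_comp)
        (Primrec.or.comp (Primrec.not.comp (PrimrecPred.decide (Primrec.eq.comp
          (Primrec.list_length.comp Primrec.snd)
          (Primrec.succ.comp (Primrec.fst.comp hd))))) ?_).to_comp
      exact (primrec_haltsBy c).comp (tl.pair (Primrec.fst.pair (Primrec.snd.comp hd)))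
    have hsucc : ∀ f k, initSeg f (k + 1) = f 0 :: initSeg (fun i => f (i + 1)) k := by
      intro f k
      simp [initSeg, List.range_succ_eq_map, Function.comp_def]
    have hRiff : ∀ n f, (∀ k, R n (initSeg f (k + 1)) = true) ↔
        (∀ k, p.test (initSeg (fun i => f (i + 1)) k) = true) ∧
          haltsBy c (initSeg (fun i => f (i + 1)) (f 0).unpair.1) n (f 0).unpair.2 = true := by
      intro n f
      simp only [R, hsucc, List.tail_cons, List.headI, List.length_cons, length_initSeg,
        Nat.add_right_cancel_iff, Bool.and_eq_true, Bool.or_eq_true, Bool.not_eq_true',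
        decide_eq_false_iff_not, forall_and]
      refine and_congr_right fun _ => ⟨fun h => (h _).resolve_left (by simp), fun h k => ?_⟩
      by_cases hk : k = (f 0).unpair.1
      · subst hk
        exact Or.inr h
      · exact Or.inl hk
    obtain ⟨n, hn, h⟩ := exists_notMem_illIndices_of_sigma11 hR fun n f hf hn => by
      obtain ⟨h₁, h₂⟩ := (hRiff n f).1 fun k => hf (k + 1)
      exact hcase n hn _ h₁ ⟨_, _, h₂⟩
    refine ⟨p, subset_rfl, fun G hG e => ?_⟩
    obtain ⟨m, j, hmj⟩ : n ∈ enumSet c G := e ▸ hn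
    let K : ℕ → ℕ := fun i => i.casesOn (Nat.pair m j) G
    refine h K fun k => ?_
    cases k with
    | zero => simpa [R, initSeg] using hG 0
    | succ k =>
      refine (hRiff n K).2 ⟨hG, ?_⟩ k
      simpa [K] using hmj

theorem exists_enumSet_ne_illIndices (p : Condition) (c : Code) :
    ∃ q : Condition, q.carrier ⊆ p.carrier ∧ ∀ G ∈ q.carrier, enumSet c G ≠ illIndices := by
  set s := p.height
  set w := p.width
  let t : ℕ → List ℕ → Bool := fun n ρ => p.test ρ &&
    !(lockCompat s w (ofNat (List ℕ) ρ.length.unpair.1) ρ &&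
      haltsBy c (ofNat (List ℕ) ρ.length.unpair.1) n ρ.length.unpair.2)
  have htc : Computable₂ t := by
    have ln : Primrec fun x : ℕ × List ℕ => x.2.length.unpair :=
      Primrec.unpair.comp (Primrec.list_length.comp Primrec.snd)
    have tau : Primrec fun x : ℕ × List ℕ => ofNat (List ℕ) x.2.length.unpair.1 :=
      (Primrec.ofNat (List ℕ)).comp (Primrec.fst.comp ln)
    refine Primrec.and.to_comp.comp (p.computable_test.comp Computable.snd)
      (Primrec.not.comp (Primrec.and.comp ((primrec_lockCompat s w).comp tau Primrec.snd)
        ?_)).to_comp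
    exact (primrec_haltsBy c).comp (tau.pair (Primrec.fst.pair (Primrec.snd.comp ln)))
  have ht : ∀ n G, (∀ k, t n (initSeg G k) = true) ↔ (∀ k, p.test (initSeg G k) = true) ∧
      ∀ H, LockEq s w G H → n ∉ enumSet c H := by
    intro n G
    simp only [t, Bool.and_eq_true, Bool.not_eq_true', forall_and, length_initSeg]
    refine and_congr_right fun _ => ⟨fun h H hGH ⟨m, j, hmj⟩ => ?_, fun h k => ?_⟩
    · have hk := h (Nat.pair (encode (initSeg H m)) (max j m))
      have hle : m ≤ Nat.pair (encode (initSeg H m)) (max j m) :=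
        (le_max_right _ _).trans (Nat.right_le_pair _ _)
      simp only [Nat.unpair_pair, ofNat_encode, Bool.and_eq_false_iff] at hk
      rcases hk with hk | hk
      · refine Bool.eq_false_iff.1 hk (lockCompat_initSeg.2 ⟨by simpa using hle, fun i hi => ?_⟩)
        rw [length_initSeg] at hi
        rw [getD_initSeg hi, hGH i]
      · exact Bool.eq_false_iff.1 hk (evaln_isSome_mono (le_max_left j m) hmj)
    · generalize ofNat (List ℕ) k.unpair.1 = τ
      by_contra hb
      rw [Bool.not_eq_false, Bool.and_eq_true, lockCompat_initSeg] at hb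
      obtain ⟨⟨-, hτ⟩, hb⟩ := hb
      refine h (fun i => if i < τ.length then τ.getD i 0 else G i) (fun i => ?_)
        ⟨τ.length, k.unpair.2, ?_⟩
      · by_cases hi : i < τ.length
        · simp only [if_pos hi, hτ i hi]
        · simp only [if_neg hi]
      · convert hb using 2
        refine List.ext_getElem (by simp) fun i h₁ h₂ => ?_
        simp [initSeg, h₂]
  by_cases hcase : ∃ n ∈ illIndices, ∃ G ∈ p.carrier, ∀ H, LockEq s w G H → n ∉ enumSet c H
  · obtain ⟨n, hn, G, hG, hnG⟩ := hcase
    refine ⟨⟨s, w, t n, ?_, ⟨G, (ht n G).2 ⟨hG, hnG⟩⟩, ?_, ?_⟩,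
      fun G hG => ((ht n G).1 hG).1, fun G hG e => ?_⟩
    · exact htc.comp (Computable.const n) Computable.id
    · intro G H hG hGH
      obtain ⟨h₁, h₂⟩ := (ht n G).1 hG
      exact (ht n H).2 ⟨p.invariant G H h₁ hGH, fun K hK => h₂ K fun i => (hGH i).trans (hK i)⟩
    · exact fun G H hG hH => p.agree G H ((ht n G).1 hG).1 ((ht n H).1 hH).1
    · exact ((ht n G).1 hG).2 G (fun _ => rfl) (e ▸ hn)
  · push Not at hcase
    obtain ⟨n, hn, h⟩ := exists_notMem_illIndices_of_sigma11 htc fun n G hG hn => by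
      obtain ⟨h₁, h₂⟩ := (ht n G).1 hG
      obtain ⟨H, hGH, hH⟩ := hcase n hn G h₁
      exact h₂ H hGH hH
    obtain ⟨G, hG⟩ := p.nonempty
    obtain ⟨H, hGH, hH⟩ : ∃ H, LockEq s w G H ∧ n ∈ enumSet c H := by
      by_contra! hno
      exact h G ((ht n G).2 ⟨hG, hno⟩)
    obtain ⟨q, hq, hqn⟩ := p.exists_forall_mem_enumSet (p.invariant G H hG hGH) hH
    exact ⟨q, hq, fun K hK e => hn (e ▸ hqn K hK)⟩

/-- The trivial condition. -/
instance : Inhabited Condition :=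
  ⟨⟨0, 0, fun _ => true, Computable.const true, ⟨fun _ => 0, fun _ => rfl⟩, fun _ _ _ _ _ => rfl,
    fun _ _ _ _ _ h => absurd h (Nat.not_lt_zero _)⟩⟩

/-- Countably many dense requirements are met by a single function. -/
theorem exists_generic {ι : Type*} [Countable ι] [Nonempty ι] (P : ι → (ℕ → ℕ) → Prop)
    (hP : ∀ i (p : Condition), ∃ q : Condition, q.carrier ⊆ p.carrier ∧ ∀ G ∈ q.carrier, P i G) :
    ∃ G, ∀ i, P i G := by
  obtain ⟨e, he⟩ := exists_surjective_nat ι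
  have step : ∀ (n : ℕ) (p : Condition), ∃ q : Condition,
      q.carrier ⊆ p.carrier ∧ n ≤ q.height ∧ ∀ G ∈ q.carrier, P (e n) G := by
    intro n p
    obtain ⟨q, hq, hn⟩ := p.exists_le_height n
    obtain ⟨r, hr, h⟩ := hP (e n) q
    obtain ⟨u, hu, hn⟩ := r.exists_le_height n
    exact ⟨u, hu.trans (hr.trans hq), hn, fun G hG => h G (hu hG)⟩
  choose next hnext hheight hmeet using step
  let c : ℕ → Condition := fun n => n.rec default fun n p => next n p
  have hc : Antitone fun n => (c n).carrier := antitone_nat_of_succ_le fun n => hnext n (c n)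
  have hne : ∀ n, ∃ G, G ∈ (c n).carrier := fun n => (c n).nonempty
  choose H hH using hne
  have hagree : ∀ i n, i + 2 ≤ n → ∀ K ∈ (c n).carrier, K i = H (i + 2) i := by
    intro i n hin K hK
    exact (c (i + 2)).agree _ _ (hc hin hK) (hH (i + 2)) i (hheight (i + 1) (c (i + 1)))
  have hG : ∀ n, (fun i => H (i + 2) i) ∈ (c n).carrier := by
    intro n k
    have := hc (le_max_left n (k + 1)) (hH (max n (k + 1))) k
    rw [← this]
    congr 1
    rw [initSeg_eq_iff]
    intro i hi
    exact (hagree i _ (by omega) _ (hH _)).symm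
  refine ⟨fun i => H (i + 2) i, fun i => ?_⟩
  obtain ⟨n, rfl⟩ := he i
  exact hmeet n (c n) _ (hG (n + 1))

end Condition

/-! ### The graph of a function as an oracle -/

/-- The graph of `G`, as a set of coded pairs. -/
def graphSet (G : ℕ → ℕ) : Set ℕ := {x | x.unpair.2 = G x.unpair.1}

theorem recursiveIn_chi_graphSet (G : ℕ → ℕ) : RecursiveIn G (chi (graphSet G)) := by
  have heq : Primrec fun x : ℕ => if x.unpair.1 = x.unpair.2 then 1 else 0 :=
    Primrec.ite (Primrec.eq.comp (Primrec.fst.comp Primrec.unpair)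
      (Primrec.snd.comp Primrec.unpair)) (.const 1) (.const 0)
  have h := (RecursiveIn.of_computable heq.to_comp).comp_total
    (RecursiveIn.pair_total .right (RecursiveIn.oracle.comp_total (O := G) .left))
  refine h.of_eq fun n => ?_
  simp [chi, graphSet]

theorem recursiveIn_of_chi_graphSet (G : ℕ → ℕ) : RecursiveIn (chi (graphSet G)) G := by
  have hsub : Primrec fun x : ℕ => 1 - x := Primrec.nat_sub.comp (.const 1) Primrec.id
  have h := RecursiveIn.rfind ((RecursiveIn.of_computable hsub.to_comp).comp_total
    (RecursiveIn.oracle (O := chi (graphSet G))))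
  refine h.of_eq fun n => Part.eq_some_iff.2 (Nat.mem_rfind.2 ⟨?_, fun {m} hm => ?_⟩)
  · simp [chi, graphSet]
  · simp [chi, graphSet, hm.ne]

/-! ### Uniform procedures yield enumerations -/

theorem partrecIn_prod_iff {O : ℕ → ℕ} {F : ℕ × ℕ →. ℕ} :
    PartrecIn O F ↔ RecursiveIn O fun n => F n.unpair := by
  unfold PartrecIn
  congr! 2 with n
  simp [Part.map_id']

theorem RecursiveIn.initSeg_code {O : ℕ → ℕ} {F : ℕ → ℕ → ℕ}
    (h : RecursiveIn O fun n : ℕ => F n.unpair.1 n.unpair.2) :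
    RecursiveIn O fun n : ℕ => encode (initSeg (F n.unpair.1) n.unpair.2) := by
  have hc : Primrec fun x : ℕ => encode (ofNat (List ℕ) x.unpair.1 ++ [x.unpair.2]) :=
    Primrec.encode.comp (Primrec.list_append.comp
      ((Primrec.ofNat (List ℕ)).comp (Primrec.fst.comp Primrec.unpair))
      (Primrec.list_cons.comp (Primrec.snd.comp Primrec.unpair) (.const [])))
  have hstep := (RecursiveIn.of_computable hc.to_comp).comp_total
    (RecursiveIn.pair_total (RecursiveIn.right.comp_total .right)
      (h.comp_total (RecursiveIn.pair_total .left (RecursiveIn.left.comp_total .right))))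
  have hrec := RecursiveIn.prec
    (RecursiveIn.of_computable (O := O) (Computable.const (encode ([] : List ℕ)))) hstep
  refine hrec.of_eq fun n => ?_
  simp only [Nat.unpaired, PFun.coe_val]
  generalize n.unpair.2 = m
  induction m with
  | zero => simp [initSeg]
  | succ m ih =>
    simp only [ih]
    simp [initSeg, List.range_succ]

theorem exists_recursiveIn_dom_iff_mem_illIndices {O : ℕ → ℕ} {F : ℕ × ℕ →. ℕ} (hF : PartrecIn O F)
    (hill : ∀ e, IllFounded (treeAt e) →
      ∃ g : ℕ → ℕ, IsPath (treeAt e) g ∧ ∀ n, F (e, n) = Part.some (g n))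
    (hwf : ∀ e, ¬ IllFounded (treeAt e) → ∀ n, ¬ (F (e, n)).Dom) :
    ∃ f : ℕ →. ℕ, RecursiveIn O f ∧ ∀ n, (f n).Dom ↔ n ∈ illIndices := by
  obtain ⟨r, hr, htree⟩ := exists_treeAt_eq_haltFree
  refine ⟨fun n => F (r n, 0), ?_, fun n => ?_⟩
  · have h := (partrecIn_prod_iff.1 hF).comp
      (RecursiveIn.pair_total (RecursiveIn.of_computable hr)
        (RecursiveIn.of_computable (Computable.const 0)))
    simpa using h
  · have hn : IllFounded (treeAt (r n)) ↔ n ∈ illIndices := by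
      rw [htree]
      exact Iff.rfl
    rw [← hn]
    refine ⟨fun h => by_contra fun hi => hwf _ hi _ h, fun h => ?_⟩
    obtain ⟨g, -, hg⟩ := hill _ h
    simp [hg]

theorem exists_recursiveIn_dom_iff_mem_compl_illIndices {O : ℕ → ℕ} {F : ℕ × ℕ → ℕ}
    (hF : ComputableIn O F)
    (hill : ∀ e, IllFounded (treeAt e) → IsPath (treeAt e) fun n => F (e, n)) :
    ∃ f : ℕ →. ℕ, RecursiveIn O f ∧ ∀ n, (f n).Dom ↔ n ∈ illIndicesᶜ := by
  obtain ⟨r, hr, htree⟩ := exists_treeAt_eq_haltFree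
  have hF' : RecursiveIn O fun n : ℕ => F (n.unpair.1, n.unpair.2) := partrecIn_prod_iff.1 hF
  have hseg := RecursiveIn.initSeg_code (F := fun n x => F (r n, x)) (by
    have h := hF'.comp_total (RecursiveIn.pair_total
      ((RecursiveIn.of_computable hr).comp_total .left) .right)
    simpa using h)
  have hc : Primrec fun x : ℕ =>
      (haltFree (ofNat Code x.unpair.1) (ofNat (List ℕ) x.unpair.2)).toNat :=
    (Primrec.dom_bool Bool.toNat).comp (primrec_haltFree.comp
      ((Primrec.ofNat Code).comp (Primrec.fst.comp Primrec.unpair))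
      ((Primrec.ofNat (List ℕ)).comp (Primrec.snd.comp Primrec.unpair)))
  have h := RecursiveIn.rfind ((RecursiveIn.of_computable hc.to_comp).comp_total
    (RecursiveIn.pair_total .left hseg))
  refine ⟨_, h, fun n => ?_⟩
  have hn : n ∈ illIndices ↔
      ∀ k, haltFree (ofNat Code n) (initSeg (fun x => F (r n, x)) k) = true := by
    refine ⟨fun hi => ?_, fun hi => ⟨_, hi⟩⟩
    have := hill (r n)
    rw [htree] at this
    exact this hi
  rw [Set.mem_compl_iff, hn]
  refine Nat.rfind_dom.trans ?_
  simp

/-- There is a set that is high for paths but neither reticently nor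
loquaciously high for paths. -/
theorem exists_highForPaths_neither_ret_nor_loq :
    ∃ X : Set ℕ, HighForPaths X ∧ ¬ RetHighForPaths X ∧ ¬ LoqHighForPaths X := by
  have : Countable {χ : List ℕ → Bool // Computable χ} := by
    have h : ∀ χ : {χ : List ℕ → Bool // Computable χ}, ∃ c : Code,
        ∀ l, c.eval (encode l) = Part.some (encode (χ.1 l)) := fun ⟨χ, hχ⟩ => by
      obtain ⟨c, hc⟩ := Code.exists_code.1 hχ
      exact ⟨c, fun l => by simp [hc]⟩
    choose c hc using h
    refine Function.Injective.countable (f := c) fun χ ψ e => Subtype.ext (funext fun l => ?_)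
    have := hc χ l
    rw [e, hc ψ l] at this
    exact (encode_injective (Part.some_injective this)).symm
  obtain ⟨G, hG⟩ := Condition.exists_generic
    (ι := Code ⊕ Code ⊕ {χ : List ℕ → Bool // Computable χ})
    (Sum.elim (fun c G => enumSet c G ≠ illIndices) (Sum.elim
      (fun c G => enumSet c G ≠ illIndicesᶜ)
      fun χ G => (∃ f, ∀ m, χ.1 (initSeg f m) = true) →
        ∃ s k, ∀ m, χ.1 (initSeg (fun x => rowEntry k (G (x + s))) m) = true)) (by
    rintro (c | c | ⟨χ, hχ⟩) p
    · exact p.exists_enumSet_ne_illIndices c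
    · exact p.exists_enumSet_ne_compl_illIndices c
    · by_cases hf : ∃ f, ∀ m, χ (initSeg f m) = true
      · obtain ⟨q, hq, s, k, h⟩ := p.exists_path hχ hf
        exact ⟨q, hq, fun G hG _ => ⟨s, k, h G hG⟩⟩
      · exact ⟨p, subset_rfl, fun _ _ h => absurd h hf⟩)
  have hX := recursiveIn_chi_graphSet G
  refine ⟨graphSet G, ?_, ?_, ?_⟩
  · rintro T ⟨-, χ, hχ, hT⟩ ⟨f, hf⟩
    obtain ⟨s, k, h⟩ := hG (.inr (.inr ⟨χ, hχ⟩)) ⟨f, fun m => (hT _).1 (hf m)⟩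
    refine ⟨_, ?_, fun m => (hT _).2 (h m)⟩
    have hadd : Primrec fun x : ℕ => x + s := Primrec.nat_add.comp Primrec.id (.const s)
    have := (RecursiveIn.of_computable (primrec_rowEntry k).to_comp).comp_total
      ((recursiveIn_of_chi_graphSet G).comp_total (RecursiveIn.of_computable hadd.to_comp))
    unfold ComputableIn PartrecIn
    simpa using this
  · rintro ⟨F, hF, hill, hwf⟩
    obtain ⟨f, hf, hdom⟩ := exists_recursiveIn_dom_iff_mem_illIndices hF hill hwf
    obtain ⟨c, hc⟩ := (hf.trans hX).exists_enumSet_eq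
    exact hG (.inl c) (Set.ext fun n => (hc n).symm.trans (hdom n))
  · rintro ⟨F, hF, hill⟩
    obtain ⟨f, hf, hdom⟩ := exists_recursiveIn_dom_iff_mem_compl_illIndices hF hill
    obtain ⟨c, hc⟩ := (hf.trans hX).exists_enumSet_eq
    exact hG (.inr (.inl c)) (Set.ext fun n => (hc n).symm.trans (hdom n))

end CFT
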